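/- arXiv:2508.18894 — 3 statements merged into one kernel-verified Lean document; each statement's English description precedes it below -/
import Mathlib

section
/- Let K : (0,∞) → (0,∞) be monotone decreasing and such that r ↦ r·K(r) is integrable on (0,∞). Fix r > 0 and set R := √(1+r²). For x ∈ ℝ² with |x| ≤ R − r let Ω_x := B_R(0) ∖ closure(B_r(x)) and f(x) := ∫_{Ω_x} ∫_{Ω_x} K(|y−z|) dy dz. Then f(0) ≤ f(x) for every x ∈ ℝ² with |x| ≤ R − r; i.e., the concentric annulus minimizes f among all admissible positions of the removed disk. -/
open MeasureTheory Set

local notation "E2" => EuclideanSpace ℝ (Fin 2)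

open scoped ENNReal

/-- Reflecting the integrand does not increase its integral over `S` if it does not increase it
at the points which the reflection moves out of `S`. -/
theorem setLIntegral_comp_involutive_le {α : Type*} [MeasurableSpace α] {μ : Measure α}
    {σ : α → α} (hσ : MeasurePreserving σ μ μ) (hinv : Function.Involutive σ)
    {S : Set α} (hS : MeasurableSet S) {F : α → ℝ≥0∞}
    (hF : ∀ z ∈ S, σ z ∉ S → F (σ z) ≤ F z) :
    ∫⁻ z in S, F (σ z) ∂μ ≤ ∫⁻ z in S, F z ∂μ := by
  have hT : MeasurableSet (σ ⁻¹' S) := hσ.measurable hS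
  have hemb : MeasurableEmbedding σ :=
    (MeasurableEquiv.ofInvolutive σ hinv hσ.measurable).measurableEmbedding
  rw [← lintegral_inter_add_sdiff (fun z => F (σ z)) S hT,
    ← lintegral_inter_add_sdiff F S hT]
  refine add_le_add (le_of_eq ?_) ?_
  · have h := hσ.setLIntegral_comp_preimage_emb hemb F (S ∩ σ ⁻¹' S)
    rwa [preimage_inter, ← preimage_comp, hinv.comp_self, preimage_id, inter_comm] at h
  · exact setLIntegral_mono' (hS.diff hT) fun z hz => hF z hz.1 hz.2

section InnerProductSpace

variable {E : Type*} [NormedAddCommGroup E] [InnerProductSpace ℝ E]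

/-- The reflection across the perpendicular bisector of `a` and `b`. -/
noncomputable def bisectorReflection (a b z : E) : E :=
  (ℝ ∙ (b - a))ᗮ.reflection (z - a) + b

theorem bisectorReflection_involutive (a b : E) :
    Function.Involutive (bisectorReflection a b) := by
  intro z
  have h : (ℝ ∙ (b - a))ᗮ.reflection (b - a) = -(b - a) :=
    Submodule.reflection_orthogonalComplement_singleton_eq_neg _
  simp only [bisectorReflection, add_sub_assoc, map_add, Submodule.reflection_reflection, h]
  abel

theorem norm_bisectorReflection_sub (a b z : E) :
    ‖bisectorReflection a b z - b‖ = ‖z - a‖ := by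
  rw [bisectorReflection, add_sub_cancel_right, LinearIsometryEquiv.norm_map]

theorem norm_sub_le_of_norm_lt_bisectorReflection {a b z : E} (hab : ‖a‖ ≤ ‖b‖)
    (hz : ‖z‖ < ‖bisectorReflection a b z‖) : ‖z - a‖ ≤ ‖z - b‖ := by
  rcases eq_or_ne a b with rfl | hne
  · rfl
  obtain ⟨u, rfl⟩ : ∃ u, b = a + u := ⟨b - a, by abel⟩
  obtain ⟨w, rfl⟩ : ∃ w, z = a + w := ⟨z - a, by abel⟩
  have hu : 0 < ‖u‖ ^ 2 := by
    have : u ≠ 0 := by rintro rfl; simp at hne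
    positivity
  have hσ : bisectorReflection a (a + u) (a + w)
      = (a + w) + (1 - 2 * (inner ℝ u w / ‖u‖ ^ 2)) • u := by
    simp only [bisectorReflection, add_sub_cancel_left, Submodule.reflection_orthogonal_apply,
      Submodule.reflection_singleton_apply, RCLike.ofReal_real_eq_id, id]
    module
  rw [hσ] at hz
  set t := inner ℝ u w / ‖u‖ ^ 2 with ht
  have htu : inner ℝ u w = t * ‖u‖ ^ 2 := by
    rw [ht, div_mul_cancel₀ _ hu.ne']
  have h1 : ‖a‖ ^ 2 ≤ ‖a + u‖ ^ 2 := by gcongr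
  have h2 : ‖a + w‖ ^ 2 < ‖(a + w) + (1 - 2 * t) • u‖ ^ 2 := by gcongr
  rw [norm_add_sq_real] at h1
  rw [norm_add_sq_real (a + w), inner_smul_right, inner_add_left, norm_smul,
    real_inner_comm u w, htu, mul_pow, Real.norm_eq_abs, sq_abs] at h2
  have h3 : 0 ≤ 1 - 2 * t := by
    by_contra! h
    nlinarith
  have h4 : ‖w‖ ^ 2 ≤ ‖w - u‖ ^ 2 := by
    rw [norm_sub_sq_real, real_inner_comm, htu]
    nlinarith
  have h5 : a + w - (a + u) = w - u := by abel
  rw [h5, add_sub_cancel_left]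
  exact le_of_sq_le_sq h4 (norm_nonneg _)

variable [FiniteDimensional ℝ E] [MeasurableSpace E] [BorelSpace E]

theorem measurePreserving_bisectorReflection (a b : E) :
    MeasurePreserving (bisectorReflection a b) :=
  (measurePreserving_add_right volume b).comp
    ((LinearIsometryEquiv.measurePreserving _).comp (measurePreserving_sub_right volume a))

/-- The integral of a radially decreasing function over a centered ball decreases as the function
is translated away from the center. -/
theorem setLIntegral_closedBall_sub_le {h : E → ℝ≥0∞} (hh : ∀ a b, ‖a‖ ≤ ‖b‖ → h b ≤ h a)
    (s : ℝ) {a b : E} (hab : ‖a‖ ≤ ‖b‖) :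
    ∫⁻ z in Metric.closedBall 0 s, h (z - b) ≤ ∫⁻ z in Metric.closedBall 0 s, h (z - a) := by
  have hrad : ∀ z, h (z - b) = h (bisectorReflection a b z - a) := fun z => by
    have hn : ‖bisectorReflection a b z - a‖ = ‖z - b‖ := by
      have := norm_bisectorReflection_sub a b (bisectorReflection a b z)
      rwa [bisectorReflection_involutive, eq_comm] at this
    exact le_antisymm (hh _ _ hn.le) (hh _ _ hn.ge)
  simp_rw [hrad]
  refine setLIntegral_comp_involutive_le (F := fun z => h (z - a))
    (measurePreserving_bisectorReflection a b)
    (bisectorReflection_involutive a b) measurableSet_closedBall fun z hz hσz => ?_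
  rw [mem_closedBall_zero_iff] at hz hσz
  rw [← hrad]
  exact hh _ _ (norm_sub_le_of_norm_lt_bisectorReflection hab (hz.trans_lt (not_le.mp hσz)))

/-- The interaction energy of two sets for the translation-invariant kernel `h`. -/
noncomputable def interaction (h : E → ℝ≥0∞) (A B : Set E) : ℝ≥0∞ :=
  ∫⁻ y in A, ∫⁻ z in B, h (y - z)

variable {h : E → ℝ≥0∞}

theorem interaction_comm (hm : Measurable h) (hneg : ∀ z, h (-z) = h z) (A B : Set E) :
    interaction h A B = interaction h B A := by
  unfold interaction
  rw [lintegral_lintegral_swap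
    (f := fun y z => h (y - z)) (hm.comp (measurable_fst.sub measurable_snd)).aemeasurable]
  refine lintegral_congr fun y => lintegral_congr fun z => ?_
  rw [← hneg, neg_sub]

theorem interaction_sdiff_add (hm : Measurable h) (hneg : ∀ z, h (-z) = h z) {B D : Set E}
    (hD : MeasurableSet D) (hDB : D ⊆ B) :
    interaction h (B \ D) (B \ D) + 2 * interaction h D B
      = interaction h B B + interaction h D D := by
  have split_left : ∀ C, interaction h B C = interaction h D C + interaction h (B \ D) C := by
    intro C
    have := lintegral_inter_add_sdiff (μ := volume) (fun y => ∫⁻ z in C, h (y - z)) B hD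
    rw [inter_eq_self_of_subset_right hDB] at this
    exact this.symm
  have split_right : ∀ C, interaction h C B = interaction h C D + interaction h C (B \ D) := by
    intro C
    rw [interaction_comm hm hneg C B, split_left, interaction_comm hm hneg C D,
      interaction_comm hm hneg C (B \ D)]
  rw [split_left B, split_right D, split_right (B \ D), interaction_comm hm hneg (B \ D) D]
  ring

theorem interaction_closedBall_self (h : E → ℝ≥0∞) (x : E) (r : ℝ) :
    interaction h (Metric.closedBall x r) (Metric.closedBall x r)
      = interaction h (Metric.closedBall 0 r) (Metric.closedBall 0 r) := by
  have key : ∀ F : E → ℝ≥0∞,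
      ∫⁻ y in Metric.closedBall x r, F y = ∫⁻ y in Metric.closedBall 0 r, F (y + x) := fun F => by
    rw [← (measurePreserving_add_right volume x).setLIntegral_comp_preimage_emb
      (measurableEmbedding_addRight x) F]
    simp
  unfold interaction
  simp_rw [key, add_sub_add_right_eq_sub]

theorem interaction_closedBall_le (hh : ∀ a b, ‖a‖ ≤ ‖b‖ → h b ≤ h a) (x : E) (r R : ℝ) :
    interaction h (Metric.closedBall x r) (Metric.closedBall 0 R)
      ≤ interaction h (Metric.closedBall 0 r) (Metric.closedBall 0 R) := by
  have hneg : ∀ z, h (-z) = h z := fun z =>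
    le_antisymm (hh _ _ (norm_neg z).ge) (hh _ _ (norm_neg z).le)
  set V : E → ℝ≥0∞ := fun y => ∫⁻ z in Metric.closedBall 0 R, h (y - z) with hV
  have hVrad : ∀ a b, ‖a‖ ≤ ‖b‖ → V b ≤ V a := fun a b hab => by
    have := setLIntegral_closedBall_sub_le hh R hab
    simp_rw [hV]
    have hsub : ∀ y z, h (y - z) = h (z - y) := fun y z => by rw [← hneg, neg_sub]
    simpa only [hV, hsub _ a, hsub _ b] using this
  have key : ∫⁻ y in Metric.closedBall x r, V y = ∫⁻ y in Metric.closedBall 0 r, V (y - -x) := by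
    rw [← (measurePreserving_add_right volume x).setLIntegral_comp_preimage_emb
      (measurableEmbedding_addRight x) V]
    simp
  have := setLIntegral_closedBall_sub_le hVrad r (a := 0) (b := -x) (by simp)
  rw [← key] at this
  simpa [interaction] using this

theorem setLIntegral_sub_le (h : E → ℝ≥0∞) (y : E) (B : Set E) :
    ∫⁻ z in B, h (y - z) ≤ ∫⁻ z, h z :=
  (setLIntegral_le_lintegral _ _).trans (lintegral_sub_left_eq_self h y).le

theorem interaction_lt_top (hfin : ∫⁻ z, h z < ∞) {A : Set E} (hA : volume A < ∞) (B : Set E) :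
    interaction h A B < ∞ := by
  calc interaction h A B ≤ ∫⁻ _ in A, ∫⁻ z, h z :=
        lintegral_mono fun y => setLIntegral_sub_le h y B
    _ = (∫⁻ z, h z) * volume A := setLIntegral_const _ _
    _ < ∞ := ENNReal.mul_lt_top hfin hA

theorem integral_integral_eq_interaction [Nontrivial E] (hm : Measurable h)
    (hfin : ∫⁻ z, h z < ∞) {g : E → ℝ} (hg : ∀ z ≠ 0, g z = (h z).toReal)
    (A B : Set E) :
    ∫ y in A, ∫ z in B, g (y - z) = (interaction h A B).toReal := by
  have hm2 : Measurable fun p : E × E => h (p.1 - p.2) :=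
    hm.comp (measurable_fst.sub measurable_snd)
  have inner_eq : ∀ y, ∫ z in B, g (y - z) = (∫⁻ z in B, h (y - z)).toReal := fun y => by
    have hmy : Measurable fun z => h (y - z) := hm.comp (measurable_const.sub measurable_id)
    rw [← integral_toReal hmy.aemeasurable
      (ae_lt_top hmy ((setLIntegral_sub_le h y B).trans_lt hfin).ne)]
    refine integral_congr_ae (ae_restrict_of_ae ?_)
    filter_upwards [Measure.ae_ne volume y] with z hz
    exact hg _ (sub_ne_zero.mpr hz.symm)
  simp_rw [inner_eq]
  rw [integral_toReal hm2.lintegral_prod_right'.aemeasurable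
    (.of_forall fun y => (setLIntegral_sub_le h y B).trans_lt hfin)]
  rfl

end InnerProductSpace

/-- The radial kernel with profile `K`, infinite at the origin. -/
noncomputable def radialKernel (K : ℝ → ℝ) (z : E2) : ℝ≥0∞ :=
  if ‖z‖ ≤ 0 then ∞ else ENNReal.ofReal (K ‖z‖)

theorem radialKernel_of_ne {K : ℝ → ℝ} {z : E2} (hz : z ≠ 0) :
    radialKernel K z = ENNReal.ofReal (K ‖z‖) :=
  if_neg (not_le.mpr (norm_pos_iff.mpr hz))

theorem antitone_radialProfile {K : ℝ → ℝ} (hK : ∀ a b : ℝ, 0 < a → a ≤ b → K b ≤ K a) :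
    Antitone fun t : ℝ => if t ≤ 0 then ∞ else ENNReal.ofReal (K t) := by
  intro a b hab
  dsimp only
  split_ifs with h1 h2 h2
  · rfl
  · exact absurd (hab.trans h1) h2
  · exact le_top
  · exact ENNReal.ofReal_le_ofReal (hK a b (not_le.mp h2) hab)

theorem lintegral_radialKernel_lt_top {K : ℝ → ℝ}
    (hK : IntegrableOn (fun ρ : ℝ => ρ * K ρ) (Ioi (0 : ℝ))) :
    ∫⁻ z, radialKernel K z < ∞ := by
  have hint : Integrable (fun z : E2 => K ‖z‖) := by
    rw [integrable_fun_norm_addHaar volume (f := K)]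
    simpa using hK
  calc ∫⁻ z, radialKernel K z = ∫⁻ z : E2, ENNReal.ofReal (K ‖z‖) := by
        refine lintegral_congr_ae ?_
        filter_upwards [Measure.ae_ne volume (0 : E2)] with z hz
        exact radialKernel_of_ne hz
    _ ≤ ∫⁻ z : E2, ‖K ‖z‖‖ₑ := lintegral_mono fun z => Real.ofReal_le_enorm _
    _ < ∞ := hint.2

/-- The concentric annulus minimizes the self-interaction energy among all
admissible positions of the removed disk (Proposition `prop:centered`, non-strict case). -/
theorem annulus_centered_minimizes
    (K : ℝ → ℝ)
    (hKpos : ∀ ρ : ℝ, 0 < ρ → 0 < K ρ)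
    (hKmono : ∀ a b : ℝ, 0 < a → a ≤ b → K b ≤ K a)
    (hKint : IntegrableOn (fun ρ : ℝ => ρ * K ρ) (Ioi (0 : ℝ)))
    (r : ℝ) (hr : 0 < r) (R : ℝ) (hR : R = Real.sqrt (1 + r ^ 2))
    (Ω : E2 → Set E2)
    (hΩ : ∀ x : E2, Ω x = Metric.ball (0 : E2) R \ closure (Metric.ball x r))
    (f : E2 → ℝ)
    (hf : ∀ x : E2, f x = ∫ y in Ω x, ∫ z in Ω x, K ‖y - z‖)
    (x : E2) (hx : ‖x‖ ≤ R - r) :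
    f 0 ≤ f x := by
  have hanti := antitone_radialProfile hKmono
  set h := radialKernel K
  have hh : ∀ a b, ‖a‖ ≤ ‖b‖ → h b ≤ h a := fun a b hab => hanti hab
  have hm : Measurable h := hanti.measurable.comp measurable_norm
  have hneg : ∀ z, h (-z) = h z := fun z =>
    le_antisymm (hh _ _ (norm_neg z).ge) (hh _ _ (norm_neg z).le)
  have hfin : ∫⁻ z, h z < ∞ := lintegral_radialKernel_lt_top hKint
  have hRpos : R ≠ 0 := by
    rw [hR]
    positivity
  set B := Metric.closedBall (0 : E2) R
  have hB : volume B < ∞ := measure_closedBall_lt_top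
  have hfeq : ∀ p, f p = (interaction h (B \ Metric.closedBall p r)
      (B \ Metric.closedBall p r)).toReal := fun p => by
    have hae : Ω p =ᵐ[volume] (B \ Metric.closedBall p r : Set E2) := by
      rw [hΩ, closure_ball p hr.ne']
      refine Filter.EventuallyEq.diff ?_ (Filter.EventuallyEq.refl _ _)
      refine Metric.ball_subset_closedBall.eventuallyLE.antisymm (ae_le_set.mpr ?_)
      rw [Metric.closedBall_sdiff_ball]
      exact Measure.addHaar_sphere_of_ne_zero volume 0 hRpos
    rw [hf, setIntegral_congr_set hae]
    simp_rw [setIntegral_congr_set hae]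
    refine integral_integral_eq_interaction (g := fun z => K ‖z‖) hm hfin (fun z hz => ?_) _ _
    rw [show h z = _ from radialKernel_of_ne hz,
      ENNReal.toReal_ofReal (hKpos _ (norm_pos_iff.mpr hz)).le]
  have hdecomp : ∀ p : E2, ‖p‖ ≤ R - r → _ := fun p hp =>
    interaction_sdiff_add hm hneg (measurableSet_closedBall (x := p) (ε := r))
      (Metric.closedBall_subset_closedBall' (y := (0 : E2)) (ε₂ := R)
        (by rw [dist_zero_right]; linarith))
  have hx0 := hdecomp x hx
  rw [interaction_closedBall_self h x r,
    ← hdecomp 0 (by simpa only [norm_zero] using (norm_nonneg x).trans hx)] at hx0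
  rw [hfeq, hfeq]
  refine ENNReal.toReal_mono
    (interaction_lt_top hfin ((measure_mono sdiff_subset).trans_lt hB) _).ne ?_
  have hD0 : 2 * interaction h (Metric.closedBall 0 r) B ≠ ∞ :=
    ENNReal.mul_ne_top (by simp) (interaction_lt_top hfin measure_closedBall_lt_top _).ne
  refine (ENNReal.add_le_add_iff_right hD0).mp (hx0.symm.trans_le ?_)
  gcongr
  exact interaction_closedBall_le hh x r R
end

section
/- Let K : (0,∞) → (0,∞) be strictly monotone decreasing and such that r ↦ r·K(r) is integrable on (0,∞). Fix r > 0 and set R := √(1+r²). For x ∈ ℝ² with |x| ≤ R − r let Ω_x := B_R(0) ∖ closure(B_r(x)) and f(x) := ∫_{Ω_x} ∫_{Ω_x} K(|y−z|) dy dz. Then x = 0 is the unique minimizer of f over {x ∈ ℝ² : |x| ≤ R − r}: for every such x with x ≠ 0 one has f(0) < f(x). -/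
open MeasureTheory Set

local notation "E2" => EuclideanSpace ℝ (Fin 2)

section RadialKernel

open Metric

variable {E : Type*} [NormedAddCommGroup E] [InnerProductSpace ℝ E]

/-- The point reflection exchanging `t • b` and `b` increases the norm on the half-space of points
closer to `t • b`. -/
lemma norm_lt_norm_smul_sub_of_norm_sub_lt {t : ℝ} (ht0 : 0 ≤ t) (ht1 : t < 1) {b z : E}
    (h : ‖z - t • b‖ < ‖z - b‖) : ‖z‖ < ‖t • b + b - z‖ := by
  have h2 : ‖z - t • b‖ ^ 2 < ‖z - b‖ ^ 2 := by gcongr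
  refine lt_of_pow_lt_pow_left₀ 2 (norm_nonneg _) ?_
  have e : t • b + b - z = (t + 1) • b - z := by module
  rw [e, norm_sub_sq_real, real_inner_smul_left, norm_smul, Real.norm_of_nonneg (by linarith)]
  rw [norm_sub_sq_real, norm_sub_sq_real, real_inner_smul_right, norm_smul,
    Real.norm_of_nonneg ht0, real_inner_comm] at h2
  have h3 : (1 - t) * (2 * inner ℝ b z) < (1 - t) * ((1 + t) * ‖b‖ ^ 2) := by linarith
  have h4 := lt_of_mul_lt_mul_left h3 (by linarith)
  nlinarith

lemma nonempty_ball_smul_diff_closedBall {ρ t : ℝ} (hρ : 0 < ρ) (ht1 : t < 1) {b : E}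
    (hb : b ≠ 0) : (ball (t • b) ρ \ closedBall b ρ).Nonempty := by
  have hb' : 0 < ‖b‖ := norm_pos_iff.2 hb
  set c := max 0 (ρ / ‖b‖ - (1 - t) / 2) with hc
  have hc0 : 0 ≤ c := le_max_left _ _
  have hc1 : c < ρ / ‖b‖ := max_lt (by positivity) (by linarith)
  have hc2 : ρ / ‖b‖ < c + (1 - t) := by
    have := le_max_right 0 (ρ / ‖b‖ - (1 - t) / 2)
    linarith
  refine ⟨t • b - c • b, ?_, ?_⟩
  · rw [mem_ball, dist_eq_norm, sub_sub_cancel_left, norm_neg, norm_smul,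
      Real.norm_of_nonneg hc0]
    exact (lt_div_iff₀ hb').1 hc1
  · have e : t • b - c • b - b = -((c + (1 - t)) • b) := by module
    rw [mem_closedBall, dist_eq_norm, not_le, e, norm_neg, norm_smul,
      Real.norm_of_nonneg (by linarith)]
    exact (div_lt_iff₀ hb').1 hc2

variable [FiniteDimensional ℝ E] [MeasurableSpace E] [BorelSpace E]

lemma setIntegral_preimage_sub_left (c : E) (g : E → ℝ) (S : Set E) :
    ∫ z in (fun z => c - z) ⁻¹' S, g (c - z) = ∫ z in S, g z :=
  (Measure.measurePreserving_sub_left volume c).setIntegral_preimage_emb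
    (MeasurableEquiv.subLeft c).measurableEmbedding g S

/-- The integral of a radially strictly decreasing function over a ball strictly decreases when the
center moves radially outwards. -/
lemma setIntegral_ball_lt_of_radially_strictAnti {g : E → ℝ}
    (hg : ∀ z z' : E, 0 < ‖z‖ → ‖z‖ < ‖z'‖ → g z' < g z) {ρ t : ℝ} (hρ : 0 < ρ)
    (ht0 : 0 ≤ t) (ht1 : t < 1) {b : E} (hb : b ≠ 0)
    (hia : IntegrableOn g (ball (t • b) ρ)) (hib : IntegrableOn g (ball b ρ)) :
    ∫ z in ball b ρ, g z < ∫ z in ball (t • b) ρ, g z := by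
  set a := t • b with ha
  have : Nontrivial E := ⟨b, 0, hb⟩
  set D := ball a ρ \ ball b ρ with hD
  have hDm : MeasurableSet D := measurableSet_ball.diff measurableSet_ball
  have hpre : (fun z => a + b - z) ⁻¹' (ball b ρ \ ball a ρ) = D := by
    ext z
    have e1 : a + b - z - b = -(z - a) := by abel
    have e2 : a + b - z - a = -(z - b) := by abel
    simp [hD, dist_eq_norm, e1, e2, -neg_sub]
  have hswap : ∫ z in ball b ρ \ ball a ρ, g z = ∫ z in D, g (a + b - z) := by
    rw [← setIntegral_preimage_sub_left (a + b) g, hpre]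
  have hgD : IntegrableOn g D := hia.mono_set sdiff_subset
  have hgD' : IntegrableOn (fun z => g (a + b - z)) D := by
    rw [← hpre]
    exact ((Measure.measurePreserving_sub_left volume (a + b)).integrableOn_comp_preimage
      (MeasurableEquiv.subLeft (a + b)).measurableEmbedding).2 (hib.mono_set sdiff_subset)
  have hlt : ∀ z ∈ D, z ≠ 0 → g (a + b - z) < g z := by
    intro z hz hz0
    refine hg _ _ (norm_pos_iff.2 hz0) (norm_lt_norm_smul_sub_of_norm_sub_lt ht0 ht1 ?_)
    rw [← dist_eq_norm, ← dist_eq_norm]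
    exact lt_of_lt_of_le (mem_ball.1 hz.1) (not_lt.1 hz.2)
  have hpos : 0 < ∫ z in D, (g z - g (a + b - z)) := by
    refine (setIntegral_pos_iff_support_of_nonneg_ae ?_ (hgD.sub hgD')).2 ?_
    · filter_upwards [ae_restrict_mem hDm, Measure.ae_ne _ (0 : E)] with z hz hz0
      exact (sub_pos.2 (hlt z hz hz0)).le
    · have hopen : IsOpen (ball a ρ \ closedBall b ρ) := isOpen_ball.sdiff isClosed_closedBall
      have h1 : 0 < volume (ball a ρ \ closedBall b ρ) :=
        hopen.measure_pos volume (nonempty_ball_smul_diff_closedBall hρ ht1 hb)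
      have h2 : volume ((ball a ρ \ closedBall b ρ) \ {0}) = volume (ball a ρ \ closedBall b ρ) :=
        measure_sdiff_null (measure_singleton 0)
      rw [← h2] at h1
      refine h1.trans_le (measure_mono fun z hz => ?_)
      have hzD : z ∈ D := ⟨hz.1.1, fun h => hz.1.2 (ball_subset_closedBall h)⟩
      exact ⟨(sub_pos.2 (hlt z hzD hz.2)).ne', hzD⟩
  rw [integral_sub hgD hgD', ← hswap] at hpos
  have e1 := integral_inter_add_sdiff (μ := volume) (measurableSet_ball (x := b) (ε := ρ)) hia
  have e2 := integral_inter_add_sdiff (μ := volume) (measurableSet_ball (x := a) (ε := ρ)) hib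
  rw [inter_comm] at e2
  rw [← e1, ← e2]
  linarith

/-- The potential of a ball centered at the origin is radially strictly decreasing. -/
lemma setIntegral_norm_sub_lt_of_norm_lt {K : ℝ → ℝ}
    (hK : ∀ a b : ℝ, 0 < a → a < b → K b < K a) (hi : Integrable fun z : E => K ‖z‖)
    {R : ℝ} (hR : 0 < R) {y y' : E} (h : ‖y‖ < ‖y'‖) :
    ∫ z in ball (0 : E) R, K ‖y' - z‖ < ∫ z in ball (0 : E) R, K ‖y - z‖ := by
  have hball : ∀ c : E, ∫ z in ball (0 : E) R, K ‖c - z‖ = ∫ z in ball c R, K ‖z‖ := by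
    intro c
    rw [← setIntegral_preimage_sub_left c fun z => K ‖z‖]
    congr 2
    ext z
    simp [dist_eq_norm]
  have hy' : 0 < ‖y'‖ := (norm_nonneg y).trans_lt h
  set t := ‖y‖ / ‖y'‖ with ht
  have ht0 : 0 ≤ t := by positivity
  have hnorm : ‖y‖ = ‖t • y'‖ := by
    rw [norm_smul, Real.norm_of_nonneg ht0, ht, div_mul_cancel₀ _ hy'.ne']
  set σ : E ≃ₗᵢ[ℝ] E := Submodule.reflection (ℝ ∙ (y - t • y'))ᗮ
  have hσ : σ y = t • y' := Submodule.reflection_sub hnorm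
  have hrad : ∫ z in ball (t • y') R, K ‖z‖ = ∫ z in ball y R, K ‖z‖ := by
    rw [← σ.measurePreserving.setIntegral_preimage_emb
      σ.toHomeomorph.measurableEmbedding, ← hσ, σ.preimage_ball]
    simp
  rw [hball, hball, ← hrad]
  exact setIntegral_ball_lt_of_radially_strictAnti (fun z z' => hK _ _) hR ht0
    ((div_lt_one hy').2 h) (norm_pos_iff.1 hy') hi.integrableOn hi.integrableOn

lemma integrable_prod_restrict_norm_sub {K : ℝ → ℝ} (hi : Integrable fun z : E => K ‖z‖)
    {S T : Set E} (hTfin : volume T ≠ ⊤) :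
    Integrable (fun p : E × E => K ‖p.1 - p.2‖)
      ((volume.restrict S).prod (volume.restrict T)) := by
  have : IsFiniteMeasure (volume.restrict T) := ⟨by simpa using hTfin.lt_top⟩
  have h := ((integrable_const (1 : ℝ)).convolution_integrand (ν := volume.restrict T)
    (ContinuousLinearMap.mul ℝ ℝ) hi)
  simp only [ContinuousLinearMap.mul_apply', one_mul] at h
  exact h.mono_measure (Measure.prod_mono Measure.restrict_le_self le_rfl)

lemma integrableOn_setIntegral_norm_sub {K : ℝ → ℝ} (hi : Integrable fun z : E => K ‖z‖)
    {S T : Set E} (hTfin : volume T ≠ ⊤) :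
    IntegrableOn (fun y => ∫ z in T, K ‖y - z‖) S :=
  (integrable_prod_restrict_norm_sub hi hTfin).integral_prod_left

lemma integral_integral_norm_sub_swap {K : ℝ → ℝ} (hi : Integrable fun z : E => K ‖z‖)
    {S T : Set E} (hTfin : volume T ≠ ⊤) :
    ∫ y in S, ∫ z in T, K ‖y - z‖ = ∫ y in T, ∫ z in S, K ‖y - z‖ := by
  rw [integral_integral_swap (integrable_prod_restrict_norm_sub hi hTfin)]
  simp_rw [norm_sub_rev]

/-- Inclusion-exclusion for the self-interaction energy of a set difference. -/
lemma integral_integral_norm_sub_diff {K : ℝ → ℝ} (hi : Integrable fun z : E => K ‖z‖)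
    {S T : Set E} (hT : MeasurableSet T) (hSfin : volume S ≠ ⊤)
    (hTS : T ⊆ S) :
    ∫ y in S \ T, ∫ z in S \ T, K ‖y - z‖ =
      (∫ y in S, ∫ z in S, K ‖y - z‖) - 2 * (∫ y in T, ∫ z in S, K ‖y - z‖)
        + ∫ y in T, ∫ z in T, K ‖y - z‖ := by
  have hTfin : volume T ≠ ⊤ := measure_ne_top_of_subset hTS hSfin
  have hk : ∀ y : E, Integrable fun z => K ‖y - z‖ := fun y => hi.comp_sub_left y
  have hint : ∀ U : Set E, IntegrableOn (fun y => ∫ z in S, K ‖y - z‖) U := fun U =>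
    integrableOn_setIntegral_norm_sub hi hSfin
  have hint' : ∀ U : Set E, IntegrableOn (fun y => ∫ z in T, K ‖y - z‖) U := fun U =>
    integrableOn_setIntegral_norm_sub hi hTfin
  simp_rw [fun y : E => setIntegral_sdiff hT (hk y).integrableOn hTS]
  rw [setIntegral_sdiff (f := fun y => (∫ z in S, K ‖y - z‖) - ∫ z in T, K ‖y - z‖) hT
    ((hint S).sub (hint' S)) hTS, integral_sub (hint S) (hint' S),
    integral_sub (hint T) (hint' T), integral_integral_norm_sub_swap hi (S := S) hTfin]
  ring

lemma integral_integral_norm_sub_ball (K : ℝ → ℝ) (x : E) (r : ℝ) :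
    ∫ y in ball x r, ∫ z in ball x r, K ‖y - z‖ =
      ∫ y in ball (0 : E) r, ∫ z in ball (0 : E) r, K ‖y - z‖ := by
  have hpre : (fun z => x - z) ⁻¹' ball x r = ball (0 : E) r := by
    ext z
    simp [dist_eq_norm]
  rw [← setIntegral_preimage_sub_left x, hpre]
  congr 1 with y
  rw [← setIntegral_preimage_sub_left x, hpre]
  congr 1 with z
  rw [sub_sub_sub_cancel_left, norm_sub_rev]

end RadialKernel

/-- For a strictly decreasing kernel, the concentric annulus is the *unique* minimizer of the
self-interaction energy among admissible positions of the removed disk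
(Proposition `prop:centered`, strict case). -/
theorem annulus_centered_unique_minimizer
    (K : ℝ → ℝ)
    (hKpos : ∀ ρ : ℝ, 0 < ρ → 0 < K ρ)
    (hKstrict : ∀ a b : ℝ, 0 < a → a < b → K b < K a)
    (hKint : IntegrableOn (fun ρ : ℝ => ρ * K ρ) (Ioi (0 : ℝ)))
    (r : ℝ) (hr : 0 < r) (R : ℝ) (hR : R = Real.sqrt (1 + r ^ 2))
    (Ω : E2 → Set E2)
    (hΩ : ∀ x : E2, Ω x = Metric.ball (0 : E2) R \ closure (Metric.ball x r))
    (f : E2 → ℝ)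
    (hf : ∀ x : E2, f x = ∫ y in Ω x, ∫ z in Ω x, K ‖y - z‖)
    (x : E2) (hx : ‖x‖ ≤ R - r) (hx0 : x ≠ 0) :
    f 0 < f x := by
  have hi : Integrable fun z : E2 => K ‖z‖ := by
    rw [integrable_fun_norm_addHaar volume]
    simpa using hKint
  have hrR : r < R := by
    rw [hR]
    exact Real.lt_sqrt_of_sq_lt (by linarith)
  have hsub : ∀ w : E2, ‖w‖ ≤ R - r → Metric.ball w r ⊆ Metric.ball 0 R := fun w hw =>
    Metric.ball_subset_ball' (by rw [dist_zero_right]; linarith)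
  have henergy : ∀ w : E2, ‖w‖ ≤ R - r →
      f w = (∫ y in Metric.ball (0 : E2) R, ∫ z in Metric.ball (0 : E2) R, K ‖y - z‖)
        - 2 * (∫ y in Metric.ball w r, ∫ z in Metric.ball (0 : E2) R, K ‖y - z‖)
        + ∫ y in Metric.ball (0 : E2) r, ∫ z in Metric.ball (0 : E2) r, K ‖y - z‖ := by
    intro w hw
    have hae : (Metric.ball (0 : E2) R \ closure (Metric.ball w r) : Set E2) =ᵐ[volume]
        (Metric.ball (0 : E2) R \ Metric.ball w r : Set E2) :=
      (ae_eq_refl _).diff (closure_ae_eq_of_null_frontier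
        ((convex_ball w r).addHaar_frontier volume))
    rw [hf, hΩ, Measure.restrict_congr_set hae,
      integral_integral_norm_sub_diff hi measurableSet_ball
        measure_ball_lt_top.ne (hsub w hw), integral_integral_norm_sub_ball K w r]
  have hpot : ∀ S : Set E2,
      IntegrableOn (fun y => ∫ z in Metric.ball (0 : E2) R, K ‖y - z‖) S := fun S =>
    integrableOn_setIntegral_norm_sub hi measure_ball_lt_top.ne
  have key := setIntegral_ball_lt_of_radially_strictAnti
    (fun _ _ _ h => setIntegral_norm_sub_lt_of_norm_lt hKstrict hi (hr.trans hrR) h)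
    hr le_rfl zero_lt_one hx0 (hpot _) (hpot _)
  rw [zero_smul] at key
  rw [henergy 0 (by simpa using hrR.le), henergy x hx]
  linarith
end

section
/- Let K > 0 and let g : [0,K] → ℝ be 1-Lipschitz with g(0) = 0. Define the set of strict record points S := {s ∈ [0,K] : g(s') < g(s) for all s' ∈ [0,s)}. Then the Lebesgue measure of [0,K] ∖ S satisfies Leb([0,K] ∖ S) ≤ K − g(K). -/
open MeasureTheory Set

/-- The points of `[0,K]` at which a continuous function fails to reach a strict record form a
measurable set. -/
theorem measurableSet_nonrecord {g : ℝ → ℝ} (hg : Continuous g) (K : ℝ) :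
    MeasurableSet {s : ℝ | s ∈ Icc 0 K ∧ ∃ s' ∈ Ico 0 s, g s ≤ g s'} := by
  have hcompact (n : ℕ) : IsCompact
      ((Icc (0 : ℝ) K ×ˢ Icc (0 : ℝ) K) ∩
        {p : ℝ × ℝ | p.2 + 1 / ((n : ℝ) + 1) ≤ p.1 ∧ g p.1 ≤ g p.2}) := by
    have hgap : IsClosed {p : ℝ × ℝ | p.2 + 1 / ((n : ℝ) + 1) ≤ p.1} :=
      isClosed_le (by fun_prop) (by fun_prop)
    have hle : IsClosed {p : ℝ × ℝ | g p.1 ≤ g p.2} := isClosed_le (by fun_prop) (by fun_prop)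
    exact (isCompact_Icc.prod isCompact_Icc).inter_right (hgap.inter hle)
  have hunion : {s : ℝ | s ∈ Icc 0 K ∧ ∃ s' ∈ Ico 0 s, g s ≤ g s'} =
      ⋃ n : ℕ, Prod.fst '' ((Icc (0 : ℝ) K ×ˢ Icc (0 : ℝ) K) ∩
        {p : ℝ × ℝ | p.2 + 1 / ((n : ℝ) + 1) ≤ p.1 ∧ g p.1 ≤ g p.2}) := by
    ext s
    simp only [mem_iUnion]
    constructor
    · rintro ⟨hs, s', hs', hle⟩
      obtain ⟨n, hn⟩ := exists_nat_one_div_lt (sub_pos.2 hs'.2)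
      exact ⟨n, (s, s'), ⟨⟨hs, hs'.1, hs'.2.le.trans hs.2⟩, by dsimp only; linarith, hle⟩, rfl⟩
    · rintro ⟨n, ⟨t, s'⟩, ⟨⟨ht, hs'⟩, hlt, hle⟩, rfl⟩
      have hn : (0 : ℝ) < 1 / ((n : ℝ) + 1) := by positivity
      dsimp only at ht hs' hlt hle ⊢
      exact ⟨ht, s', ⟨hs'.1, by linarith⟩, hle⟩
  rw [hunion]
  exact MeasurableSet.iUnion fun n => ((hcompact n).image continuous_fst).measurableSet

/-- Every value in `(g 0, g K]` of a continuous function `g` is attained at a strict record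
point. -/
theorem Ioc_subset_image_record {g : ℝ → ℝ} (hg : Continuous g) {K : ℝ} (hK : 0 ≤ K) :
    Ioc (g 0) (g K) ⊆ g '' {s : ℝ | s ∈ Icc 0 K ∧ ∀ s' ∈ Ico 0 s, g s' < g s} := by
  intro y hy
  have hcompact : IsCompact (Icc 0 K ∩ {t | y ≤ g t}) :=
    isCompact_Icc.inter_right (isClosed_le continuous_const hg)
  obtain ⟨s, ⟨hs, hys⟩, hmin⟩ := hcompact.exists_isLeast ⟨K, ⟨hK, le_rfl⟩, hy.2⟩
  have hlt : ∀ s' ∈ Ico 0 s, g s' < y := fun s' hs' => by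
    by_contra! h
    exact (hmin ⟨⟨hs'.1, hs'.2.le.trans hs.2⟩, h⟩).not_gt hs'.2
  obtain ⟨t, ht, rfl⟩ := intermediate_value_Icc hs.1 hg.continuousOn ⟨hy.1.le, hys⟩
  have hts : t = s := by
    by_contra h
    exact (hlt t ⟨ht.1, lt_of_le_of_ne ht.2 h⟩).false
  subst hts
  exact ⟨t, ⟨hs, hlt⟩, rfl⟩

/-- A `1`-Lipschitz real function does not increase Lebesgue outer measure. -/
theorem volume_image_le_of_lipschitzWith_one {g : ℝ → ℝ} (hg : LipschitzWith 1 g) (s : Set ℝ) :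
    volume (g '' s) ≤ volume s := by
  simpa [hausdorffMeasure_real] using hg.hausdorffMeasure_image_le zero_le_one s

/-- The complement of the set of strict record points of a `1`-Lipschitz function `g` on `[0,K]`
with `g(0) = 0` has Lebesgue measure at most `K − g(K)` (Step 3 of the proof of
Proposition `prop:lower_bound`). -/
theorem record_points_measure_bound
    (K : ℝ) (hK : 0 < K) (g : ℝ → ℝ)
    (hg : LipschitzOnWith 1 g (Icc 0 K)) (hg0 : g 0 = 0) :
    volume (Icc 0 K \ {s : ℝ | s ∈ Icc 0 K ∧ ∀ s' ∈ Ico 0 s, g s' < g s})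
      ≤ ENNReal.ofReal (K - g K) := by
  obtain ⟨h, hh, hgh⟩ := hg.extend_real
  have hrecord : {s : ℝ | s ∈ Icc 0 K ∧ ∀ s' ∈ Ico 0 s, g s' < g s} =
      {s : ℝ | s ∈ Icc 0 K ∧ ∀ s' ∈ Ico 0 s, h s' < h s} := by
    ext s
    refine and_congr_right fun hs => forall₂_congr fun s' hs' => ?_
    rw [hgh hs, hgh ⟨hs'.1, hs'.2.le.trans hs.2⟩]
  rw [hrecord, hgh ⟨hK.le, le_rfl⟩]
  have h0 : h 0 = 0 := by rw [← hgh ⟨le_rfl, hK.le⟩, hg0]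
  set S := {s : ℝ | s ∈ Icc 0 K ∧ ∀ s' ∈ Ico 0 s, h s' < h s} with hS
  have hsub : S ⊆ Icc 0 K := fun s hs => hs.1
  have hcompl : Icc 0 K \ S = {s : ℝ | s ∈ Icc 0 K ∧ ∃ s' ∈ Ico 0 s, h s ≤ h s'} := by
    ext s
    simp only [hS, mem_sdiff, mem_ofPred_eq, not_and, not_forall, not_lt, exists_prop]
    exact and_congr_right fun hs => ⟨fun H => H hs, fun H _ => H⟩
  have hmeas : MeasurableSet S := by
    rw [← sdiff_sdiff_cancel_left hsub, hcompl]
    exact measurableSet_Icc.diff (measurableSet_nonrecord hh.continuous K)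
  have hvol : ENNReal.ofReal (h K) ≤ volume S := calc
    ENNReal.ofReal (h K) = volume (Ioc (h 0) (h K)) := by rw [Real.volume_Ioc, h0, sub_zero]
    _ ≤ volume (h '' S) := measure_mono (Ioc_subset_image_record hh.continuous hK.le)
    _ ≤ volume S := volume_image_le_of_lipschitzWith_one hh S
  rw [measure_sdiff hsub hmeas.nullMeasurableSet (measure_ne_top_of_subset hsub (by simp)),
    Real.volume_Icc, tsub_le_iff_right]
  calc ENNReal.ofReal (K - 0) = ENNReal.ofReal ((K - h K) + h K) := by ring_nf
    _ ≤ ENNReal.ofReal (K - h K) + ENNReal.ofReal (h K) := ENNReal.ofReal_add_le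
    _ ≤ ENNReal.ofReal (K - h K) + volume S := by gcongr
end
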